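/- Under the block eigenvalue setup, suppose γ = p(s+1) + s. Then lim_{d→∞} d^{(p+1)s} · D*(d) = R · a_{p+1}^s · ((p+1)!)^s + σ²/(α · p!). -/

import Mathlib

open Filter

/-- `N(d,k)`, the dimension of the space of degree-`k` spherical harmonics on `S^d`:
`N(d,0) = 1` and, for `k ≥ 1`,
`N(d,k) = ((2k + d − 1)/k) · (k + d − 2)! / ((d − 1)! (k − 1)!)`. -/
noncomputable def sphDim (d k : ℕ) : ℝ :=
  if k = 0 then 1
  else ((2 * k + d - 1 : ℝ) / k) * (Nat.factorial (k + d - 2)) /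
    (Nat.factorial (d - 1) * Nat.factorial (k - 1))

/-- `v_k(d) := Σ_{k'=0}^{k} N(d,k')`. -/
noncomputable def vdim (d k : ℕ) : ℝ :=
  ∑ k' ∈ Finset.range (k + 1), sphDim d k'

/-- `v_{k-1}(d)`, with the convention `v_{−1}(d) = 0`. -/
noncomputable def vprev (d k : ℕ) : ℝ :=
  ∑ k' ∈ Finset.range k, sphDim d k'

/-- The left-hand side `(σ²/(nκ)) · Σ_{j=1}^{∞} λ_j^{-s/2}(1 − κλ_j^{-s/2})_+` of the
Pinsker equation (the sum over `j ≥ 1` is written as a sum over `j + 1`, `j : ℕ`). -/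
noncomputable def pinskerLHS (s σ : ℝ) (n : ℕ) (lam : ℕ → ℝ) (κ : ℝ) : ℝ :=
  σ ^ 2 / (n * κ) *
    ∑' j : ℕ, lam (j + 1) ^ (-(s / 2)) * max (1 - κ * lam (j + 1) ^ (-(s / 2))) 0

/-- The Pinsker weights `ℓ_j := (1 − κ* λ_j^{-s/2})_+`. -/
noncomputable def pinskerEll (s : ℝ) (lam : ℕ → ℝ) (κstar : ℝ) (j : ℕ) : ℝ :=
  max (1 - κstar * lam j ^ (-(s / 2))) 0

/-- `N := max { j ≥ 1 : λ_j^{s/2} > κ* }`. -/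
noncomputable def blockN (s : ℝ) (lam : ℕ → ℝ) (κstar : ℝ) : ℕ :=
  sSup {j : ℕ | 1 ≤ j ∧ κstar < lam j ^ (s / 2)}

/-- `D* := (σ²/n) Σ_{j=1}^{N} ℓ_j`. -/
noncomputable def pinskerD (s σ : ℝ) (n : ℕ) (lam : ℕ → ℝ) (κstar : ℝ) : ℝ :=
  σ ^ 2 / n * ∑ j ∈ Finset.Icc 1 (blockN s lam κstar), pinskerEll s lam κstar j

/-- The natural number equal to `sphDim d k` for `d ≥ 1`. -/
def harmDim (d : ℕ) : ℕ → ℕ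
  | 0 => 1
  | k + 1 => (d + k).choose (k + 1) + (d - 1 + k).choose k

/-- The partial sums of `harmDim`, equal to `vprev` for `d ≥ 1`. -/
def harmSum (d k : ℕ) : ℕ := ∑ i ∈ Finset.range k, harmDim d i

lemma harmSum_succ (d k : ℕ) : harmSum d (k + 1) = harmSum d k + harmDim d k :=
  Finset.sum_range_succ _ _

lemma harmDim_pos (d k : ℕ) : 0 < harmDim d k := by
  cases k with
  | zero => exact Nat.one_pos
  | succ k => exact Nat.add_pos_right _ (Nat.choose_pos (Nat.le_add_left _ _))

lemma sphDim_eq_harmDim {d : ℕ} (hd : 0 < d) (k : ℕ) : sphDim d k = harmDim d k := by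
  obtain ⟨e, rfl⟩ : ∃ e, d = e + 1 := ⟨d - 1, by omega⟩
  cases k with
  | zero => simp [sphDim, harmDim]
  | succ k =>
    have h1 : ((e + k + 1 : ℕ) : ℝ) * ((e + k).choose k : ℕ)
        = ((e + k + 1).choose (k + 1) : ℕ) * (k + 1 : ℕ) := by
      exact_mod_cast Nat.add_one_mul_choose_eq (e + k) k
    have h2 : (((e + k).choose k : ℕ) : ℝ) * e.factorial * k.factorial = (e + k).factorial := by
      have := Nat.add_choose_mul_factorial_mul_factorial e k
      exact_mod_cast this
    have e1 : k + 1 + (e + 1) - 2 = e + k := by omega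
    have e2 : e + 1 + k = e + k + 1 := by omega
    simp only [sphDim, harmDim, Nat.add_one_ne_zero, if_false, e1, e2, Nat.add_sub_cancel]
    rw [← h2]
    have hk : (k.factorial : ℝ) ≠ 0 := by positivity
    have he : (e.factorial : ℝ) ≠ 0 := by positivity
    have hk1 : (k : ℝ) + 1 ≠ 0 := by positivity
    push_cast at h1 ⊢
    field_simp
    linear_combination h1

lemma vprev_eq_harmSum {d : ℕ} (hd : 0 < d) (k : ℕ) : vprev d k = harmSum d k := by
  simp [vprev, harmSum, sphDim_eq_harmDim hd]

lemma vdim_eq_harmSum {d : ℕ} (hd : 0 < d) (k : ℕ) : vdim d k = harmSum d (k + 1) :=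
  vprev_eq_harmSum hd (k + 1)

lemma tendsto_choose_div_pow (c k : ℕ) :
    Tendsto (fun d : ℕ => ((d + c).choose k : ℝ) / (d : ℝ) ^ k) atTop
      (nhds (1 / (k.factorial : ℝ))) := by
  have h0 : Tendsto (fun d : ℕ => (d : ℝ) ^ k / k.factorial / ((d : ℝ) ^ k)) atTop
      (nhds (1 / (k.factorial : ℝ))) := by
    refine tendsto_const_nhds.congr' ?_
    filter_upwards [eventually_gt_atTop 0] with d hd
    field_simp
  have h1 : Tendsto (fun d : ℕ => (d.choose k : ℝ) / (d : ℝ) ^ k) atTop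
      (nhds (1 / (k.factorial : ℝ))) :=
    ((isEquivalent_choose k).div Asymptotics.IsEquivalent.refl).symm.tendsto_nhds h0
  have h2 : Tendsto (fun d : ℕ => (((d + c : ℕ) : ℝ) / d) ^ k) atTop (nhds 1) := by
    have : Tendsto (fun d : ℕ => 1 + (c : ℝ) / d) atTop (nhds (1 + 0)) :=
      tendsto_const_nhds.add (tendsto_const_div_atTop_nhds_zero_nat _)
    have h := this.pow k
    simp only [add_zero, one_pow] at h
    refine h.congr' ?_
    filter_upwards [eventually_gt_atTop 0] with d hd
    push_cast
    field_simp
  have h3 := (h1.comp (tendsto_add_atTop_nat c)).mul h2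
  rw [mul_one] at h3
  refine h3.congr' ?_
  filter_upwards [eventually_gt_atTop 0] with d hd
  have : ((d + c : ℕ) : ℝ) ≠ 0 := by positivity
  simp only [Function.comp, div_pow]
  field_simp

lemma tendsto_harmDim_div_pow (k : ℕ) :
    Tendsto (fun d : ℕ => (harmDim d k : ℝ) / (d : ℝ) ^ k) atTop
      (nhds (1 / (k.factorial : ℝ))) := by
  cases k with
  | zero => simp [harmDim]
  | succ k =>
    have h2 : Tendsto (fun d : ℕ => ((d - 1 + k).choose k : ℝ) / (d : ℝ) ^ (k + 1)) atTop
        (nhds 0) := by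
      have h := (tendsto_choose_div_pow k k).mul
        (tendsto_const_div_atTop_nhds_zero_nat (1 : ℝ))
      rw [mul_zero] at h
      refine squeeze_zero (fun d => by positivity) (fun d => ?_) h
      rw [div_mul_div_comm, mul_one, ← pow_succ]
      gcongr
      omega
    have h := (tendsto_choose_div_pow k (k + 1)).add h2
    rw [add_zero] at h
    refine h.congr fun d => ?_
    simp only [harmDim]
    push_cast
    ring

lemma sum_range_eq_sum_blocks {c : ℕ → ℕ} {V : ℕ → ℕ} (hV0 : V 0 = 0)
    (hV : ∀ k, V (k + 1) = V k + c k) {f g : ℕ → ℝ} {K : ℕ}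
    (h : ∀ k < K, ∀ j, V k ≤ j → j < V (k + 1) → f j = g k) :
    ∑ j ∈ Finset.range (V K), f j = ∑ k ∈ Finset.range K, (c k : ℝ) * g k := by
  induction K with
  | zero => simp [hV0]
  | succ K ih =>
    rw [Finset.sum_range_succ, ← ih fun k hk => h k (by omega), hV, Finset.sum_range_add]
    congr 1
    rw [Finset.sum_congr rfl fun i hi => h K (by omega) (V K + i) (by omega)
      (by rw [hV]; have := Finset.mem_range.1 hi; omega)]
    simp

lemma pinskerD_eq_sum_range {s σ κ : ℝ} {n M : ℕ} {lam : ℕ → ℝ}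
    (hpos : ∀ j, 1 ≤ j → 0 < lam j)
    (hM : ∀ j, M ≤ j → 1 ≤ κ * lam (j + 1) ^ (-(s / 2))) :
    pinskerD s σ n lam κ
      = σ ^ 2 / n * ∑ j ∈ Finset.range M, max (1 - κ * lam (j + 1) ^ (-(s / 2))) 0 := by
  have key : ∀ j, 1 ≤ j → (κ < lam j ^ (s / 2) ↔ κ * lam j ^ (-(s / 2)) < 1) := fun j hj => by
    have := Real.rpow_pos_of_pos (hpos j hj) (s / 2)
    rw [Real.rpow_neg (hpos j hj).le, ← div_eq_mul_inv, div_lt_one this]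
  have hbd : ∀ j ∈ {j : ℕ | 1 ≤ j ∧ κ < lam j ^ (s / 2)}, j ≤ M := fun j hj => by
    by_contra! hlt
    have h1 := hM (j - 1) (by omega)
    rw [Nat.sub_add_cancel hj.1] at h1
    exact absurd ((key j hj.1).1 hj.2) (not_lt.2 h1)
  have hle : blockN s lam κ ≤ M := by
    rcases Set.eq_empty_or_nonempty {j : ℕ | 1 ≤ j ∧ κ < lam j ^ (s / 2)} with h | h
    · simp [blockN, h]
    · exact csSup_le h hbd
  have hzero : ∀ j, blockN s lam κ ≤ j → max (1 - κ * lam (j + 1) ^ (-(s / 2))) 0 = 0 := by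
    intro j hj
    refine max_eq_right (sub_nonpos.2 ?_)
    by_contra! hlt
    have := le_csSup ⟨M, hbd⟩
      (show j + 1 ∈ {j : ℕ | 1 ≤ j ∧ κ < lam j ^ (s / 2)} from
        ⟨by omega, (key _ (by omega)).2 hlt⟩)
    change j + 1 ≤ blockN s lam κ at this
    omega
  unfold pinskerD pinskerEll
  rw [← Finset.sum_subset (Finset.range_mono hle) fun j _ hj => hzero j (by simpa using hj)]
  rw [Finset.range_eq_Ico, Finset.sum_Ico_add' (fun j => max (1 - κ * lam j ^ (-(s / 2))) 0) 0 _ 1]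
  rfl

lemma tsum_mul_max_eq_sum_range {u : ℕ → ℝ} {κ : ℝ} {M : ℕ} (hM : ∀ j, M ≤ j → 1 ≤ κ * u j) :
    ∑' j, u j * max (1 - κ * u j) 0 = ∑ j ∈ Finset.range M, u j * max (1 - κ * u j) 0 :=
  tsum_eq_sum fun j hj => by
    rw [max_eq_right (sub_nonpos.2 (hM j (by simpa using hj))), mul_zero]

lemma sum_range_le_tsum_mul_max {u : ℕ → ℝ} {κ : ℝ} (hκ : 0 < κ) (hu : ∀ j, 0 ≤ u j)
    (hlim : Tendsto u atTop atTop) (M : ℕ) :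
    ∑ j ∈ Finset.range M, u j * max (1 - κ * u j) 0 ≤ ∑' j, u j * max (1 - κ * u j) 0 := by
  obtain ⟨M₀, hM₀⟩ := eventually_atTop.1 (hlim.eventually_ge_atTop (1 / κ))
  refine Summable.sum_le_tsum _ (fun j _ => mul_nonneg (hu j) (le_max_right _ _)) ?_
  refine summable_of_ne_finset_zero (s := Finset.range M₀) fun j hj => ?_
  have h := hM₀ j (by simpa using hj)
  rw [div_le_iff₀' hκ] at h
  rw [max_eq_right (sub_nonpos.2 h), mul_zero]

lemma tendsto_rpow_neg_shift_atTop {s : ℝ} (hs : 0 < s) {lam : ℕ → ℝ}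
    (hpos : ∀ j, 1 ≤ j → 0 < lam j) (hlim : Tendsto lam atTop (nhds 0)) :
    Tendsto (fun j => lam (j + 1) ^ (-(s / 2))) atTop atTop := by
  refine (tendsto_rpow_neg_nhdsGT_zero (y := -(s / 2)) (by linarith)).comp ?_
  refine tendsto_nhdsWithin_iff.2 ⟨hlim.comp (tendsto_add_atTop_nat 1), ?_⟩
  exact Eventually.of_forall fun j => hpos _ (by omega)

/-- If the Pinsker equation determines `x` and the value `D` through finitely many blocks with
weights `A k` and ratios `r k`, and only the critical block `p + 1` is partially active, then `D`
has an explicit limit. -/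
lemma tendsto_of_block_equations {p : ℕ} {R L B : ℝ} (hR : 0 < R) (hL : 0 < L)
    {A r : ℕ → ℕ → ℝ} {E x D : ℕ → ℝ} (hE : Tendsto E atTop (nhds L))
    (hA0 : ∀ k < p, Tendsto (A k) atTop (nhds 0)) (hAp : Tendsto (A p) atTop (nhds B))
    (hAp1 : Tendsto (A (p + 1)) atTop atTop) (hA : ∀ k d, 0 ≤ A k d)
    (hr0 : ∀ k ≤ p, Tendsto (r k) atTop (nhds 0)) (hr1 : ∀ᶠ d in atTop, r (p + 1) d = 1)
    (hr2 : Tendsto (r (p + 2)) atTop atTop)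
    (hrx : ∀ᶠ d in atTop, ∀ k ≤ p + 2, 0 ≤ x d * r k d ∧ 0 ≤ r k d)
    (hEpos : ∀ᶠ d in atTop, 0 < E d)
    (heq : ∀ᶠ d in atTop, ∀ K ≤ p + 2, 1 ≤ x d * r K d →
      R * E d * x d = ∑ k ∈ Finset.range K, A k d * (r k d * max (1 - x d * r k d) 0))
    (hD : ∀ᶠ d in atTop, ∀ K ≤ p + 2, 1 ≤ x d * r K d →
      D d = ∑ k ∈ Finset.range K, A k d * max (1 - x d * r k d) 0)
    (hle : ∀ᶠ d in atTop,
      A (p + 1) d * (r (p + 1) d * max (1 - x d * r (p + 1) d) 0) ≤ R * E d * x d) :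
    Tendsto D atTop (nhds (R * L + B)) := by
  have hAlim : ∀ k ≤ p, ∃ l, Tendsto (A k) atTop (nhds l) := fun k hk => by
    rcases hk.lt_or_eq with h | rfl
    · exact ⟨0, hA0 k h⟩
    · exact ⟨B, hAp⟩
  have hS : Tendsto (fun d => ∑ k ∈ Finset.range (p + 1), A k d * r k d) atTop (nhds 0) := by
    have : Tendsto (fun d => ∑ k ∈ Finset.range (p + 1), A k d * r k d) atTop
        (nhds (∑ k ∈ Finset.range (p + 1), 0)) := by
      refine tendsto_finsetSum _ fun k hk => ?_
      have hk' : k ≤ p := by have := Finset.mem_range.1 hk; omega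
      obtain ⟨l, hl⟩ := hAlim k hk'
      simpa using hl.mul (hr0 k hk')
    simpa using this
  have hRE : Tendsto (fun d => R * E d) atTop (nhds (R * L)) := hE.const_mul R
  have hlt : ∀ᶠ d in atTop, x d < 1 := by
    filter_upwards [hS.eventually_lt hRE (by positivity), heq, hr1, hrx, hEpos]
      with d h1 h2 h3 h4 h5
    by_contra! hx
    have h6 := h2 (p + 1) (by omega) (by rw [h3, mul_one]; exact hx)
    have h7 : ∑ k ∈ Finset.range (p + 1), A k d * (r k d * max (1 - x d * r k d) 0)
        ≤ ∑ k ∈ Finset.range (p + 1), A k d * r k d := by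
      refine Finset.sum_le_sum fun k hk => mul_le_mul_of_nonneg_left ?_ (hA k d)
      have h8 := h4 k (by have := Finset.mem_range.1 hk; omega)
      exact mul_le_of_le_one_right h8.2 (max_le (by linarith [h8.1]) zero_le_one)
    have h9 : R * E d ≤ R * E d * x d := le_mul_of_one_le_right (by positivity) hx
    linarith
  have hx1 : Tendsto x atTop (nhds 1) := by
    have h0 : Tendsto (fun d => 1 - R * E d / A (p + 1) d) atTop (nhds 1) := by
      simpa using (hRE.div_atTop hAp1).const_sub 1
    refine tendsto_of_tendsto_of_tendsto_of_le_of_le' h0 tendsto_const_nhds ?_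
      (hlt.mono fun d h => h.le)
    filter_upwards [hlt, hle, hr1, hAp1.eventually_gt_atTop 0, hEpos] with d h1 h2 h3 h4 h5
    rw [h3, one_mul, mul_one] at h2
    have h6 : A (p + 1) d * (1 - x d) ≤ R * E d :=
      (mul_le_mul_of_nonneg_left (le_max_left _ _) h4.le).trans
        (h2.trans (mul_le_of_le_one_right (by positivity) h1.le))
    rw [sub_le_comm, le_div_iff₀' h4]
    exact h6
  have hcut : ∀ᶠ d in atTop, 1 ≤ x d * r (p + 2) d :=
    (hx1.pos_mul_atTop one_pos hr2).eventually_ge_atTop 1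
  have hmain : Tendsto (fun d => R * E d * x d + ∑ k ∈ Finset.range (p + 1),
      A k d * (max (1 - x d * r k d) 0 * (1 - r k d))) atTop (nhds (R * L * 1 + B)) := by
    refine (hRE.mul hx1).add ?_
    have hl : ∀ k ≤ p, Tendsto (fun d => max (1 - x d * r k d) 0 * (1 - r k d)) atTop
        (nhds 1) := fun k hk => by
      have h := (((hx1.mul (hr0 k hk)).const_sub 1).max
        (tendsto_const_nhds (x := (0 : ℝ)))).mul ((hr0 k hk).const_sub 1)
      simpa using h
    have hlow : Tendsto (fun d => ∑ k ∈ Finset.range p,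
        A k d * (max (1 - x d * r k d) 0 * (1 - r k d))) atTop
        (nhds (∑ k ∈ Finset.range p, 0)) := by
      refine tendsto_finsetSum _ fun k hk => ?_
      have hk' := Finset.mem_range.1 hk
      simpa using (hA0 k hk').mul (hl k hk'.le)
    simp only [Finset.sum_range_succ]
    simpa using hlow.add (hAp.mul (hl p le_rfl))
  rw [mul_one] at hmain
  refine hmain.congr' ?_
  filter_upwards [hcut, heq, hD, hr1] with d h1 h2 h3 h4
  rw [h3 _ le_rfl h1, h2 _ le_rfl h1, Finset.sum_range_succ _ (p + 1),
    Finset.sum_range_succ _ (p + 1), h4, one_mul, add_right_comm, ← Finset.sum_add_distrib]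
  congr 1
  exact Finset.sum_congr rfl fun k _ => by ring

lemma tendsto_div_of_tendsto_pow_mul {f g : ℕ → ℝ} {k l : ℕ} (hkl : k < l) {b c : ℝ} (hb : b ≠ 0)
    (hf : Tendsto (fun d : ℕ => (d : ℝ) ^ k * f d) atTop (nhds b))
    (hg : Tendsto (fun d : ℕ => (d : ℝ) ^ l * g d) atTop (nhds c)) :
    Tendsto (fun d => g d / f d) atTop (nhds 0) := by
  have h1 : Tendsto (fun d : ℕ => ((d : ℝ) ^ (l - k))⁻¹) atTop (nhds 0) :=
    ((tendsto_pow_atTop (by omega)).comp tendsto_natCast_atTop_atTop).inv_tendsto_atTop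
  have h := (hg.div hf hb).mul h1
  rw [mul_zero] at h
  refine h.congr' ?_
  filter_upwards [eventually_gt_atTop 0, hf.eventually_ne hb] with d hd hne
  have hfd : f d ≠ 0 := right_ne_zero_of_mul hne
  obtain ⟨m, rfl⟩ := Nat.exists_eq_add_of_lt hkl
  have e : k + m + 1 - k = m + 1 := by omega
  rw [e, Pi.div_apply]
  have hd' : (d : ℝ) ≠ 0 := by positivity
  field_simp
  ring

/-- With `n ~ α d ^ γ`, the rescaled dimension of the `k`-th block equals the product of a
convergent sequence and the power `d ^ (k - p)`. -/
lemma block_weight_eventuallyEq {s σ γ : ℝ} {p : ℕ} (hγeq : γ = (p : ℝ) * (s + 1) + s)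
    {n : ℕ → ℕ} (hn : ∀ d, 0 < n d) (k : ℕ) :
    (fun d : ℕ => σ ^ 2 * ((harmDim d k : ℝ) / (d : ℝ) ^ k) / ((n d : ℝ) / (d : ℝ) ^ γ)
        * (d : ℝ) ^ ((k : ℝ) - p)) =ᶠ[atTop]
      fun d : ℕ => (d : ℝ) ^ (((p : ℝ) + 1) * s) * (σ ^ 2 / n d) * harmDim d k := by
  filter_upwards [eventually_gt_atTop 0] with d hd
  have hd' : (0 : ℝ) < d := by positivity
  have hnd : (n d : ℝ) ≠ 0 := by have := hn d; positivity
  have e : (d : ℝ) ^ ((k : ℝ) - p) * (d : ℝ) ^ γ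
      = (d : ℝ) ^ (((p : ℝ) + 1) * s) * (d : ℝ) ^ k := by
    rw [← Real.rpow_natCast (d : ℝ) k, ← Real.rpow_add hd', ← Real.rpow_add hd', hγeq]
    congr 1
    ring
  field_simp
  linear_combination σ ^ 2 * (harmDim d k : ℝ) * e

lemma tendsto_block_weight_ratio {σ α γ : ℝ} (hα : α ≠ 0) {n : ℕ → ℕ}
    (hnlim : Tendsto (fun d : ℕ => (n d : ℝ) / (d : ℝ) ^ γ) atTop (nhds α)) (k : ℕ) :
    Tendsto (fun d : ℕ => σ ^ 2 * ((harmDim d k : ℝ) / (d : ℝ) ^ k) / ((n d : ℝ) / (d : ℝ) ^ γ))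
      atTop (nhds (σ ^ 2 / (α * k.factorial))) := by
  have h := ((tendsto_harmDim_div_pow k).const_mul (σ ^ 2)).div hnlim hα
  rwa [mul_one_div, div_div, mul_comm _ α] at h

/-- The block structure at a fixed dimension: the eigenvalues beyond an inactive block are
inactive. -/
lemma one_le_mul_rpow_of_block {s κ m : ℝ} (hs : 0 < s) (hκ : 0 < κ) {lam : ℕ → ℝ} {M : ℕ}
    (hpos : ∀ j, 1 ≤ j → 0 < lam j) (hanti : ∀ i j, 1 ≤ i → i ≤ j → lam j ≤ lam i)
    (hM : lam (M + 1) = m) (hm : 1 ≤ κ * m ^ (-(s / 2))) (j : ℕ) (hj : M ≤ j) :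
    1 ≤ κ * lam (j + 1) ^ (-(s / 2)) := by
  refine hm.trans (mul_le_mul_of_nonneg_left ?_ hκ.le)
  exact Real.rpow_le_rpow_of_nonpos (hpos _ (by omega))
    (hM ▸ hanti (M + 1) (j + 1) (by omega) (by omega)) (by linarith)

/-- The Pinsker equation multiplied by the normalisation of the critical block `p + 1`. -/
lemma rescaled_pinsker_identity {s σ R κ m : ℝ} {p d n : ℕ} {lam : ℕ → ℝ} (hd : 0 < d)
    (hn : 0 < n) (hm : 0 < m) (hκ : 0 < κ) (heq : pinskerLHS s σ n lam κ = R) :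
    R * ((d : ℝ) ^ (p + 1) * m) ^ s * (κ * m ^ (-(s / 2)))
      = (d : ℝ) ^ (((p : ℝ) + 1) * s) * (σ ^ 2 / n) / m ^ (-(s / 2)) *
        ∑' j : ℕ, lam (j + 1) ^ (-(s / 2)) * max (1 - κ * lam (j + 1) ^ (-(s / 2))) 0 := by
  have hd' : (0 : ℝ) < d := by positivity
  have hn' : (0 : ℝ) < n := by positivity
  have h1 : ((d : ℝ) ^ (p + 1) * m) ^ s = (d : ℝ) ^ (((p : ℝ) + 1) * s) * m ^ s := by
    rw [Real.mul_rpow (by positivity) hm.le, ← Real.rpow_natCast, ← Real.rpow_mul hd'.le]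
    push_cast
    rfl
  have h2 : m ^ s = m ^ (s / 2) * m ^ (s / 2) := by
    rw [← Real.rpow_add hm, add_halves]
  have h3 := Real.rpow_pos_of_pos hm (s / 2)
  rw [h1, h2, ← heq, pinskerLHS, Real.rpow_neg hm.le (s / 2)]
  field_simp

/-- If `γ = p(s+1) + s` then `d^{(p+1)s} · D*(d) → R a_{p+1}^s ((p+1)!)^s + σ²/(α p!)`. -/
theorem statement14
    (s R σ α γ : ℝ) (hs : 0 < s) (hR : 0 < R) (hσ : 0 < σ) (hα : 0 < α) (hγ : 0 < γ)
    (p : ℕ) (hp : p = ⌊γ / (s + 1)⌋₊)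
    (a : ℕ → ℝ) (ha : ∀ k ≤ p + 3, 0 < a k)
    (n : ℕ → ℕ) (hn : ∀ d, 0 < n d)
    (hnlim : Tendsto (fun d : ℕ => (n d : ℝ) / (d : ℝ) ^ γ) atTop (nhds α))
    (μ : ℕ → ℕ → ℝ)
    (hμlim : ∀ k ≤ p + 3, Tendsto (fun d : ℕ => (d : ℝ) ^ k * μ d k) atTop
      (nhds (a k * Nat.factorial k)))
    (hμorder : ∀ᶠ d in atTop, (∀ k < p + 2, μ d (k + 1) < μ d k) ∧ 0 < μ d (p + 2))
    (lam : ℕ → ℕ → ℝ)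
    (hlampos : ∀ d j, 1 ≤ j → 0 < lam d j)
    (hlamanti : ∀ d i j, 1 ≤ i → i ≤ j → lam d j ≤ lam d i)
    (hlamlim : ∀ d, Tendsto (lam d) atTop (nhds 0))
    (hblock : ∀ᶠ d in atTop, ∀ k ≤ p + 2, ∀ j : ℕ,
      vprev d k < (j : ℝ) → (j : ℝ) ≤ vdim d k → lam d j = μ d k)
    (κstar : ℕ → ℝ)
    (hκ : ∀ d, 0 < κstar d ∧ pinskerLHS s σ (n d) (lam d) (κstar d) = R)
    (hγeq : γ = (p : ℝ) * (s + 1) + s) :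
    Tendsto (fun d : ℕ =>
        (d : ℝ) ^ (((p : ℝ) + 1) * s) * pinskerD s σ (n d) (lam d) (κstar d))
      atTop (nhds (R * a (p + 1) ^ s * (Nat.factorial (p + 1) : ℝ) ^ s +
        σ ^ 2 / (α * Nat.factorial p))) := by
  have hb : ∀ k ≤ p + 3, 0 < a k * Nat.factorial k := fun k hk =>
    mul_pos (ha k hk) (by positivity)
  have hμpos : ∀ᶠ d : ℕ in atTop, ∀ k ≤ p + 2, 0 < μ d k := by
    have h : ∀ᶠ d : ℕ in atTop, ∀ k ∈ Finset.range (p + 3), 0 < μ d k := by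
      rw [Finset.eventually_all]
      intro k hk
      have hk' : k ≤ p + 3 := (Finset.mem_range.1 hk).le
      filter_upwards [(hμlim k hk').eventually_const_lt (hb k hk')] with d hd
      exact pos_of_mul_pos_right hd (by positivity)
    exact h.mono fun d hd k hk => hd k (Finset.mem_range.2 (by omega))
  have hblock' : ∀ᶠ d : ℕ in atTop, ∀ k ≤ p + 2, ∀ j, harmSum d k ≤ j → j < harmSum d (k + 1) →
      lam d (j + 1) = μ d k := by
    filter_upwards [hblock, eventually_gt_atTop 0] with d h hd k hk j h1 h2
    refine h k hk (j + 1) ?_ ?_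
    · rw [vprev_eq_harmSum hd]
      exact_mod_cast Nat.lt_succ_of_le h1
    · rw [vdim_eq_harmSum hd]
      exact_mod_cast h2
  have hdiv : ∀ k l, k < l → l ≤ p + 2 → Tendsto (fun d => μ d l / μ d k) atTop (nhds 0) :=
    fun k l hkl hl => tendsto_div_of_tendsto_pow_mul hkl (hb k (by omega)).ne'
      (hμlim k (by omega)) (hμlim l (by omega))
  rw [mul_assoc, ← Real.mul_rpow (ha _ (by omega)).le (by positivity)]
  refine tendsto_of_block_equations (p := p) hR (Real.rpow_pos_of_pos (hb (p + 1) (by omega)) s)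
    (A := fun k d => (d : ℝ) ^ (((p : ℝ) + 1) * s) * (σ ^ 2 / n d) * harmDim d k)
    (r := fun k d => μ d k ^ (-(s / 2)) / μ d (p + 1) ^ (-(s / 2)))
    (E := fun d => ((d : ℝ) ^ (p + 1) * μ d (p + 1)) ^ s)
    (x := fun d => κstar d * μ d (p + 1) ^ (-(s / 2)))
    ?_ ?_ ?_ ?_ ?_ ?_ ?_ ?_ ?_ ?_ ?_ ?_ ?_
  · exact (hμlim (p + 1) (by omega)).rpow_const (Or.inr hs.le)
  · intro k hk
    have h := (tendsto_block_weight_ratio (σ := σ) hα.ne' hnlim k).mul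
      ((tendsto_rpow_neg_atTop (y := (p : ℝ) - k) (by
        have : (k : ℝ) < p := by exact_mod_cast hk
        linarith)).comp tendsto_natCast_atTop_atTop)
    rw [mul_zero] at h
    refine Tendsto.congr' ((EventuallyEq.of_eq ?_).trans
      (block_weight_eventuallyEq hγeq hn k)) h
    funext d
    simp [neg_sub]
  · refine Tendsto.congr' (block_weight_eventuallyEq hγeq hn p) ?_
    simpa using tendsto_block_weight_ratio (σ := σ) hα.ne' hnlim p
  · have h := (tendsto_block_weight_ratio (σ := σ) hα.ne' hnlim (p + 1)).pos_mul_atTop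
      (by positivity) tendsto_natCast_atTop_atTop
    refine Tendsto.congr' ((EventuallyEq.of_eq ?_).trans
      (block_weight_eventuallyEq hγeq hn (p + 1))) h
    funext d
    simp
  · intro k d
    positivity
  · intro k hk
    have h := (hdiv k (p + 1) (by omega) (by omega)).rpow_const (p := s / 2)
      (Or.inr (by positivity))
    rw [Real.zero_rpow (by positivity)] at h
    refine h.congr' ?_
    filter_upwards [hμpos] with d hd
    have h1 := hd k (by omega)
    have h2 := hd (p + 1) (by omega)
    rw [Real.div_rpow h2.le h1.le, Real.rpow_neg h1.le, Real.rpow_neg h2.le, inv_div_inv]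
  · filter_upwards [hμpos] with d hd
    exact div_self (Real.rpow_pos_of_pos (hd (p + 1) (by omega)) _).ne'
  · have h := (tendsto_rpow_neg_nhdsGT_zero (y := -(s / 2)) (by linarith)).comp
      (tendsto_nhdsWithin_iff.2 ⟨hdiv (p + 1) (p + 2) (by omega) le_rfl, hμpos.mono fun d hd =>
        div_pos (hd (p + 2) le_rfl) (hd (p + 1) (by omega))⟩)
    refine h.congr' ?_
    filter_upwards [hμpos] with d hd
    exact Real.div_rpow (hd (p + 2) le_rfl).le (hd (p + 1) (by omega)).le _
  · filter_upwards [hμpos] with d hd k hk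
    have h1 := Real.rpow_pos_of_pos (hd k hk) (-(s / 2))
    have h2 := Real.rpow_pos_of_pos (hd (p + 1) (by omega)) (-(s / 2))
    have h3 := (hκ d).1
    constructor <;> positivity
  · filter_upwards [hμpos, eventually_gt_atTop 0] with d hd h0
    have h2 := hd (p + 1) (by omega)
    positivity
  · filter_upwards [hμpos, hblock', eventually_gt_atTop 0] with d hd hbl h0 K hK hcut
    have hm := Real.rpow_pos_of_pos (hd (p + 1) (by omega)) (-(s / 2))
    rw [rescaled_pinsker_identity h0 (hn d) (hd (p + 1) (by omega)) (hκ d).1 (hκ d).2]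
    have hx : ∀ y, κstar d * μ d (p + 1) ^ (-(s / 2)) * (y / μ d (p + 1) ^ (-(s / 2)))
        = κstar d * y := fun y => by field_simp
    simp only [hx] at hcut ⊢
    have hM := one_le_mul_rpow_of_block hs (hκ d).1 (hlampos d) (hlamanti d)
      (hbl K hK (harmSum d K) le_rfl (by rw [harmSum_succ]; have := harmDim_pos d K; omega)) hcut
    rw [tsum_mul_max_eq_sum_range (u := fun j => lam d (j + 1) ^ (-(s / 2))) hM,
      sum_range_eq_sum_blocks (c := harmDim d) (V := harmSum d) rfl (harmSum_succ d)
        (g := fun k => μ d k ^ (-(s / 2)) * max (1 - κstar d * μ d k ^ (-(s / 2))) 0)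
        (fun k hk j h1 h2 => by simp only [hbl k (by omega) j h1 h2]), Finset.mul_sum]
    exact Finset.sum_congr rfl fun k _ => by ring
  · filter_upwards [hμpos, hblock'] with d hd hbl K hK hcut
    have hm := Real.rpow_pos_of_pos (hd (p + 1) (by omega)) (-(s / 2))
    have hx : ∀ y, κstar d * μ d (p + 1) ^ (-(s / 2)) * (y / μ d (p + 1) ^ (-(s / 2)))
        = κstar d * y := fun y => by field_simp
    simp only [hx] at hcut ⊢
    have hM := one_le_mul_rpow_of_block hs (hκ d).1 (hlampos d) (hlamanti d)
      (hbl K hK (harmSum d K) le_rfl (by rw [harmSum_succ]; have := harmDim_pos d K; omega)) hcut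
    rw [pinskerD_eq_sum_range (hlampos d) hM,
      sum_range_eq_sum_blocks (c := harmDim d) (V := harmSum d) rfl (harmSum_succ d)
        (g := fun k => max (1 - κstar d * μ d k ^ (-(s / 2))) 0)
        (fun k hk j h1 h2 => by simp only [hbl k (by omega) j h1 h2]), ← mul_assoc, Finset.mul_sum]
    exact Finset.sum_congr rfl fun k _ => by ring
  · filter_upwards [hμpos, hblock', eventually_gt_atTop 0] with d hd hbl h0
    have hm := Real.rpow_pos_of_pos (hd (p + 1) (by omega)) (-(s / 2))
    rw [rescaled_pinsker_identity h0 (hn d) (hd (p + 1) (by omega)) (hκ d).1 (hκ d).2,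
      div_self hm.ne', mul_one, one_mul]
    have h1 := sum_range_le_tsum_mul_max (u := fun j => lam d (j + 1) ^ (-(s / 2))) (hκ d).1
      (fun j => (Real.rpow_pos_of_pos (hlampos d _ (by omega)) _).le)
      (tendsto_rpow_neg_shift_atTop hs (hlampos d) (hlamlim d)) (harmSum d (p + 2))
    rw [sum_range_eq_sum_blocks (c := harmDim d) (V := harmSum d) rfl (harmSum_succ d)
        (g := fun k => μ d k ^ (-(s / 2)) * max (1 - κstar d * μ d k ^ (-(s / 2))) 0)
        (fun k hk j h1 h2 => by simp only [hbl k (by omega) j h1 h2])] at h1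
    have h2 := (Finset.single_le_sum (f := fun k => (harmDim d k : ℝ) *
      (μ d k ^ (-(s / 2)) * max (1 - κstar d * μ d k ^ (-(s / 2))) 0)) (fun k hk => by
        have := Real.rpow_pos_of_pos (hd k (by have := Finset.mem_range.1 hk; omega)) (-(s / 2))
        positivity) (Finset.mem_range.2 (show p + 1 < p + 2 by omega))).trans h1
    refine le_trans (le_of_eq ?_) (mul_le_mul_of_nonneg_left h2
      (show 0 ≤ (d : ℝ) ^ (((p : ℝ) + 1) * s) * (σ ^ 2 / n d) / μ d (p + 1) ^ (-(s / 2)) by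
        positivity))
    field_simp
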